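/- arXiv:2101.06260 — 2 statements merged into one kernel-verified Lean document; each statement's English description precedes it below -/
import Mathlib

section
/- Let r ≥ 2 be an integer and let (S₁, S₂) be an Euler pair of order r, i.e., rS₁ ⊆ S₁ and S₂ = S₁ \ rS₁. Then for all non-negative integers n and j, b̃_{j,r}(n) = (r−1)·((j+1)·|Õ_{j+1,r}(n)| − j·|Õ_{j,r}(n)|) = (r−1)·((j+1)·|D̃_{j+1,r}(n)| − j·|D̃_{j,r}(n)|), where the equalities hold in the integers. -/
open Finset

/-- `rS`: the set `{r·s : s ∈ S}` of `r`-fold multiples of elements of `S`. -/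
def rSet (r : ℕ) (S : Set ℕ) : Set ℕ := (fun s => r * s) '' S

/-- `Õ_{j,r}(n)`: partitions of `n` with exactly `j` different parts from `rS₁` and all
other parts from `S₂`. -/
noncomputable def setOt (S1 S2 : Set ℕ) (j r n : ℕ) : Finset (Nat.Partition n) :=
  letI := Classical.propDecidable
  Finset.univ.filter fun p =>
    (p.parts.toFinset.filter fun i => i ∈ rSet r S1).card = j ∧
      ∀ i ∈ p.parts.toFinset, i ∉ rSet r S1 → i ∈ S2

/-- `D̃_{j,r}(n)`: partitions of `n` with all parts in `S₁` and exactly `j` different parts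
repeated at least `r` times (all other parts appearing at most `r - 1` times). -/
noncomputable def setDt (S1 : Set ℕ) (j r n : ℕ) : Finset (Nat.Partition n) :=
  letI := Classical.propDecidable
  Finset.univ.filter fun p =>
    (∀ i ∈ p.parts, i ∈ S1) ∧
      (p.parts.toFinset.filter fun i => r ≤ p.parts.count i).card = j

/-- `Õ_{≤j,r}(n)`: partitions of `n` with at most `j` different parts from `rS₁` and all
other parts from `S₂`. -/
noncomputable def setOtLe (S1 S2 : Set ℕ) (j r n : ℕ) : Finset (Nat.Partition n) :=
  letI := Classical.propDecidable
  Finset.univ.filter fun p =>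
    (p.parts.toFinset.filter fun i => i ∈ rSet r S1).card ≤ j ∧
      ∀ i ∈ p.parts.toFinset, i ∉ rSet r S1 → i ∈ S2

/-- `D̃_{≤j,r}(n)`: partitions of `n` with all parts in `S₁` and at most `j` different parts
repeated at least `r` times. -/
noncomputable def setDtLe (S1 : Set ℕ) (j r n : ℕ) : Finset (Nat.Partition n) :=
  letI := Classical.propDecidable
  Finset.univ.filter fun p =>
    (∀ i ∈ p.parts, i ∈ S1) ∧
      (p.parts.toFinset.filter fun i => r ≤ p.parts.count i).card ≤ j

/-- The number of parts of a partition. -/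
def numParts {n : ℕ} (p : Nat.Partition n) : ℕ := Multiset.card p.parts

/-- The number of different parts of a partition. -/
def numDistinctParts {n : ℕ} (p : Nat.Partition n) : ℕ := p.parts.toFinset.card

/-- `b̃_{j,r}(n)`: the difference between the number of parts in all partitions in
`Õ_{j,r}(n)` and the number of parts in all partitions in `D̃_{j,r}(n)`. -/
noncomputable def bDifft (S1 S2 : Set ℕ) (j r n : ℕ) : ℤ :=
  (∑ p ∈ setOt S1 S2 j r n, (numParts p : ℤ)) - ∑ p ∈ setDt S1 j r n, (numParts p : ℤ)

/-- `b̃_{≤j,r}(n)`. -/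
noncomputable def bDifftLe (S1 S2 : Set ℕ) (j r n : ℕ) : ℤ :=
  (∑ p ∈ setOtLe S1 S2 j r n, (numParts p : ℤ)) - ∑ p ∈ setDtLe S1 j r n, (numParts p : ℤ)

/-- `b̃'_{j,r}(n)`: the difference between the number of different parts in all partitions
in `D̃_{j,r}(n)` and the number of different parts in all partitions in `Õ_{j,r}(n)`. -/
noncomputable def bDifft' (S1 S2 : Set ℕ) (j r n : ℕ) : ℤ :=
  (∑ p ∈ setDt S1 j r n, (numDistinctParts p : ℤ)) -
    ∑ p ∈ setOt S1 S2 j r n, (numDistinctParts p : ℤ)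

/-- `b̃'_{≤j,r}(n)`. -/
noncomputable def bDifftLe' (S1 S2 : Set ℕ) (j r n : ℕ) : ℤ :=
  (∑ p ∈ setDtLe S1 j r n, (numDistinctParts p : ℤ)) -
    ∑ p ∈ setOtLe S1 S2 j r n, (numDistinctParts p : ℤ)

/-- `T̃_{j,r}(n)`: the number of different parts with multiplicity between `r + 1` and
`2r - 1` in all partitions in `D̃_{j,r}(n)`. -/
noncomputable def Tcountt (S1 : Set ℕ) (j r n : ℕ) : ℕ :=
  ∑ p ∈ setDt S1 j r n,
    (p.parts.toFinset.filter fun i =>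
      r + 1 ≤ p.parts.count i ∧ p.parts.count i ≤ 2 * r - 1).card

/-- `(S₁, S₂)` is an Euler pair of order `r` if `rS₁ ⊆ S₁` and `S₂ = S₁ \ rS₁`. -/
def IsEulerPair (r : ℕ) (S1 S2 : Set ℕ) : Prop :=
  rSet r S1 ⊆ S1 ∧ S2 = S1 \ rSet r S1

open Classical in
/-- Partitions of `n` with all parts in `S`. -/
noncomputable def epbP (S : Set ℕ) (n : ℕ) : Finset (Nat.Partition n) :=
  Finset.univ.filter fun p => ∀ i ∈ p.parts, i ∈ S

open Classical in
/-- The elements of `S` up to `n`. -/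
noncomputable def epbU (S : Set ℕ) (n : ℕ) : Finset ℕ := (range (n + 1)).filter (· ∈ S)

/-- The number of `s ∈ S` such that `d * s` is repeated at least `c` times in `p`. -/
noncomputable def epbN (S : Set ℕ) (c d : ℕ) {n : ℕ} (p : Nat.Partition n) : ℕ :=
  ((epbU S n).filter fun s => c ≤ p.parts.count (d * s)).card

/-- The union of the blocks removed. -/
def epbM (c d : ℕ) (T : Finset ℕ) : Multiset ℕ := ∑ s ∈ T, Multiset.replicate c (d * s)

lemma epb_inv (N : ℕ) (x : ℕ → ℤ) (hx : ∀ j, N < j → x j = 0)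
    (h : ∀ k, ∑ j ∈ range (N + 1), (j.choose k : ℤ) * x j = 0) : ∀ j, x j = 0 := by
  have key : ∀ m k, N ≤ k + m → x k = 0 := by
    intro m
    induction m using Nat.strong_induction_on with
    | _ m ih =>
      intro k hk
      by_cases hkN : N < k
      · exact hx k hkN
      have hs := h k
      rw [Finset.sum_eq_single k] at hs
      · simpa using hs
      · intro j hj hjk
        rcases lt_or_gt_of_ne hjk with hlt | hgt
        · simp [Nat.choose_eq_zero_of_lt hlt]
        · have : x j = 0 := by
            by_cases hm : m = 0
            · exact hx j (by omega)
            · exact ih (m - 1) (by omega) j (by omega)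
          simp [this]
      · intro hk'
        simp at hk'
        omega
  intro j
  exact key N j (by omega)

lemma epb_M_le (c d : ℕ) (hd : 0 < d) (T : Finset ℕ) (l : Multiset ℕ) :
    epbM c d T ≤ l ↔ ∀ s ∈ T, c ≤ l.count (d * s) := by
  have hc : ∀ a, (epbM c d T).count a = ∑ s ∈ T, if d * s = a then c else 0 := by
    intro a
    simp only [epbM, Multiset.count_sum', Multiset.count_replicate]
  have hc' : ∀ s ∈ T, (epbM c d T).count (d * s) = c := by
    intro s hs
    rw [hc, Finset.sum_eq_single s]
    · simp
    · intro t _ hts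
      rw [if_neg]
      intro h
      exact hts (Nat.eq_of_mul_eq_mul_left hd h)
    · intro h; exact absurd hs h
  rw [Multiset.le_iff_count]
  constructor
  · intro h s hs
    rw [← hc' s hs]
    exact h _
  · intro h a
    by_cases ha : ∃ s ∈ T, d * s = a
    · obtain ⟨s, hs, rfl⟩ := ha
      rw [hc' s hs]
      exact h s hs
    · rw [hc, Finset.sum_eq_zero]
      · exact Nat.zero_le _
      · intro s hs
        rw [if_neg]
        intro h'
        exact ha ⟨s, hs, h'⟩

lemma epb_M_card (c d : ℕ) (T : Finset ℕ) : Multiset.card (epbM c d T) = c * T.card := by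
  simp [epbM, Multiset.card_sum, mul_comm]

lemma epb_M_sum (c d : ℕ) (T : Finset ℕ) : (epbM c d T).sum = c * d * ∑ s ∈ T, s := by
  unfold epbM
  rw [Multiset.sum_sum]
  simp [Finset.mul_sum, mul_assoc]

lemma epb_M_mem (c d : ℕ) (T : Finset ℕ) (a : ℕ) (h : a ∈ epbM c d T) :
    ∃ s ∈ T, a = d * s := by
  unfold epbM at h
  rw [Multiset.mem_sum] at h
  obtain ⟨s, hs, h⟩ := h
  exact ⟨s, hs, Multiset.eq_of_mem_replicate h⟩

open Classical in
lemma epb_remove (S : Set ℕ) (hS : ∀ s ∈ S, 0 < s) (M : Multiset ℕ) (hM : ∀ a ∈ M, a ∈ S)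
    (n : ℕ) (g : ℕ → ℤ) :
    ∑ p ∈ (epbP S n).filter (fun p => M ≤ p.parts), g (numParts p) =
      if M.sum ≤ n then ∑ p ∈ epbP S (n - M.sum), g (numParts p + Multiset.card M) else 0 := by
  split_ifs with hn
  · symm
    refine Finset.sum_bij
      (fun p _ => (⟨p.parts + M, by
        intro i hi
        rcases Multiset.mem_add.1 hi with h | h
        · exact p.parts_pos h
        · exact hS _ (hM _ h), by
        rw [Multiset.sum_add, p.parts_sum]; omega⟩ : Nat.Partition n)) ?_ ?_ ?_ ?_
    · intro p hp
      simp only [epbP, Finset.mem_filter, Finset.mem_univ, true_and] at hp ⊢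
      refine ⟨?_, by simp⟩
      intro i hi
      rcases Multiset.mem_add.1 hi with h | h
      · exact hp _ h
      · exact hM _ h
    · intro p _ q _ h
      have h' := congrArg Nat.Partition.parts h
      simp only [add_left_inj] at h'
      exact Nat.Partition.ext h'
    · intro p hp
      simp only [epbP, Finset.mem_filter, Finset.mem_univ, true_and] at hp
      have hle := tsub_add_cancel_of_le hp.2
      refine ⟨⟨p.parts - M, ?_, ?_⟩, ?_, ?_⟩
      · intro i hi
        exact p.parts_pos (Multiset.mem_of_le tsub_le_self hi)
      · have := congrArg Multiset.sum hle
        rw [Multiset.sum_add, p.parts_sum] at this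
        omega
      · simp only [epbP, Finset.mem_filter, Finset.mem_univ, true_and]
        intro i hi
        exact hp.1 _ (Multiset.mem_of_le tsub_le_self hi)
      · exact Nat.Partition.ext hle
    · intro p _
      simp [numParts]
  · apply Finset.sum_eq_zero
    intro p hp
    exfalso
    simp only [Finset.mem_filter] at hp
    have hle := tsub_add_cancel_of_le hp.2
    have := congrArg Multiset.sum hle
    rw [Multiset.sum_add, p.parts_sum] at this
    omega

open Classical in
lemma epb_main (S : Set ℕ) (hS : ∀ s ∈ S, 0 < s) (r c d : ℕ) (hcd : c * d = r) (hd : 0 < d)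
    (hdS : ∀ s ∈ S, d * s ∈ S) (n k : ℕ) (g : ℕ → ℤ) :
    ∑ p ∈ epbP S n, ((epbN S c d p).choose k : ℤ) * g (numParts p) =
      ∑ T ∈ (epbU S n).powersetCard k,
        if r * ∑ s ∈ T, s ≤ n then
          ∑ p ∈ epbP S (n - r * ∑ s ∈ T, s), g (numParts p + c * k) else 0 := by
  have h1 : ∀ p ∈ epbP S n, ((epbN S c d p).choose k : ℤ) * g (numParts p) =
      ∑ T ∈ (epbU S n).powersetCard k, if epbM c d T ≤ p.parts then g (numParts p) else 0 := by
    intro p _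
    rw [← Finset.sum_filter, Finset.sum_const, nsmul_eq_mul]
    congr 2
    rw [epbN, ← Finset.card_powersetCard]
    congr 1
    ext T
    simp only [Finset.mem_powersetCard, Finset.mem_filter, epb_M_le c d hd,
      Finset.subset_iff]
    constructor
    · rintro ⟨h, h'⟩
      exact ⟨⟨fun s hs => (h hs).1, h'⟩, fun s hs => (h hs).2⟩
    · rintro ⟨⟨h, h'⟩, h''⟩
      exact ⟨fun s hs => ⟨h hs, h'' s hs⟩, h'⟩
  rw [Finset.sum_congr rfl h1, Finset.sum_comm]
  apply Finset.sum_congr rfl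
  intro T hT
  rw [Finset.mem_powersetCard] at hT
  rw [← Finset.sum_filter, epb_remove S hS (epbM c d T) _ n g, epb_M_sum, hcd, epb_M_card, hT.2]
  intro a ha
  obtain ⟨s, hs, rfl⟩ := epb_M_mem c d T a ha
  have := hT.1 hs
  simp only [epbU, Finset.mem_filter] at this
  exact hdS s this.2

lemma epb_N_le (S : Set ℕ) (c d n : ℕ) (p : Nat.Partition n) : epbN S c d p ≤ n + 1 := by
  classical
  unfold epbN epbU
  refine (Finset.card_filter_le _ _).trans ((Finset.card_filter_le _ _).trans ?_)
  simp

lemma epb_ind (a k N : ℕ) (ha : a ≤ N) :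
    ∑ j ∈ range (N + 1), (j.choose k : ℤ) *
      (((j : ℤ) + 1) * (if a = j + 1 then 1 else 0) - (j : ℤ) * (if a = j then 1 else 0)) =
      - ((k : ℤ) * (a.choose k : ℤ)) := by
  simp only [mul_sub, Finset.sum_sub_distrib]
  have h2 : ∑ j ∈ range (N + 1), (j.choose k : ℤ) * ((j : ℤ) * (if a = j then 1 else 0)) =
      (a.choose k : ℤ) * a := by
    rw [Finset.sum_eq_single a]
    · simp
    · intro b _ hb; simp [Ne.symm hb]
    · intro h; simp at h; omega
  rw [h2]
  cases a with
  | zero =>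
    cases k <;> simp
  | succ m =>
    rw [Finset.sum_eq_single m]
    · cases k with
      | zero => simp
      | succ k =>
        have e1 : ((m : ℤ) + 1) * (m.choose k : ℤ) = ((m + 1).choose (k + 1) : ℤ) * (k + 1) := by
          exact_mod_cast Nat.add_one_mul_choose_eq m k
        have e2 : ((m + 1).choose (k + 1) : ℤ) = m.choose k + m.choose (k + 1) := by
          exact_mod_cast Nat.choose_succ_succ m k
        simp only [if_true]
        push_cast
        linear_combination (-1) * e1 - ((m : ℤ) + 1) * e2
    · intro b _ hb
      rw [if_neg (by omega)]; simp
    · intro h; simp at h; omega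

lemma epb_fib {α : Type*} (P : Finset α) (a : α → ℕ) (l : α → ℤ) (N k : ℕ)
    (ha : ∀ p ∈ P, a p ≤ N) :
    ∑ j ∈ range (N + 1), (j.choose k : ℤ) * ∑ p ∈ P.filter (fun p => a p = j), l p =
      ∑ p ∈ P, ((a p).choose k : ℤ) * l p := by
  rw [← Finset.sum_fiberwise_of_maps_to (s := P) (t := range (N + 1)) (g := a)
    (fun p hp => by have := ha p hp; simp; omega)]
  apply Finset.sum_congr rfl
  intro j _
  rw [Finset.mul_sum]
  apply Finset.sum_congr rfl
  intro p hp
  rw [(Finset.mem_filter.1 hp).2]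

lemma epb_fib2 {α : Type*} (P : Finset α) (a : α → ℕ) (N k : ℕ)
    (ha : ∀ p ∈ P, a p ≤ N) :
    ∑ j ∈ range (N + 1), (j.choose k : ℤ) *
      (((j : ℤ) + 1) * ((P.filter (fun p => a p = j + 1)).card : ℤ) -
        (j : ℤ) * ((P.filter (fun p => a p = j)).card : ℤ)) =
      - ((k : ℤ) * ∑ p ∈ P, ((a p).choose k : ℤ)) := by
  rw [Finset.mul_sum, ← Finset.sum_neg_distrib]
  rw [← Finset.sum_congr rfl (fun p hp => epb_ind (a p) k N (ha p hp)), Finset.sum_comm]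
  apply Finset.sum_congr rfl
  intro j _
  rw [← Finset.mul_sum, Finset.sum_sub_distrib, ← Finset.mul_sum, ← Finset.mul_sum]
  rw [Finset.sum_boole, Finset.sum_boole]

lemma epb_setOt (r : ℕ) (hr : 2 ≤ r) (S1 S2 : Set ℕ) (hpair : IsEulerPair r S1 S2) (n j : ℕ) :
    setOt S1 S2 j r n = (epbP S1 n).filter (fun p => epbN S1 1 r p = j) := by
  classical
  obtain ⟨hsub, rfl⟩ := hpair
  ext p
  simp only [setOt, epbP, Finset.mem_filter, Finset.mem_univ, true_and]
  have h1 : (∀ i ∈ p.parts.toFinset, i ∉ rSet r S1 → i ∈ S1 \ rSet r S1) ↔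
      ∀ i ∈ p.parts, i ∈ S1 := by
    constructor
    · intro h i hi
      by_cases hi' : i ∈ rSet r S1
      · exact hsub hi'
      · exact (h i (by simpa using hi) hi').1
    · intro h i hi hi'
      exact ⟨h i (by simpa using hi), hi'⟩
  have h2 : (p.parts.toFinset.filter fun i => i ∈ rSet r S1).card = epbN S1 1 r p := by
    unfold epbN
    symm
    refine Finset.card_bij (fun s _ => r * s) ?_ ?_ ?_
    · intro s hs
      simp only [epbU, Finset.mem_filter, Multiset.mem_toFinset] at hs ⊢
      exact ⟨Multiset.one_le_count_iff_mem.1 hs.2, s, hs.1.2, rfl⟩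
    · intro s _ t _ h
      exact Nat.eq_of_mul_eq_mul_left (by omega) h
    · intro i hi
      simp only [Finset.mem_filter, Multiset.mem_toFinset] at hi
      obtain ⟨hi, s, hs, rfl⟩ := hi
      refine ⟨s, ?_, rfl⟩
      simp only [epbU, Finset.mem_filter, Finset.mem_range]
      have := Multiset.le_sum_of_mem hi
      rw [p.parts_sum] at this
      simp only at this
      refine ⟨⟨?_, hs⟩, Multiset.one_le_count_iff_mem.2 hi⟩
      nlinarith
  rw [← h1, ← h2, and_comm]
  convert Iff.rfl

lemma epb_setDt (r : ℕ) (hr : 2 ≤ r) (S1 : Set ℕ) (n j : ℕ) :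
    setDt S1 j r n = (epbP S1 n).filter (fun p => epbN S1 r 1 p = j) := by
  classical
  ext p
  simp only [setDt, epbP, Finset.mem_filter, Finset.mem_univ, true_and]
  apply and_congr_right
  intro h
  have h2 : (p.parts.toFinset.filter fun i => r ≤ p.parts.count i) =
      (epbU S1 n).filter fun s => r ≤ p.parts.count (1 * s) := by
    ext i
    simp only [epbU, Finset.mem_filter, Multiset.mem_toFinset, Finset.mem_range, one_mul]
    constructor
    · rintro ⟨hi, hc⟩
      have := Multiset.le_sum_of_mem hi
      rw [p.parts_sum] at this
      exact ⟨⟨by omega, h i hi⟩, hc⟩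
    · rintro ⟨_, hc⟩
      exact ⟨Multiset.one_le_count_iff_mem.1 (by omega), hc⟩
  rw [epbN, ← h2]
  convert Iff.rfl

/-- For an Euler pair `(S₁, S₂)` of order `r`,
`b̃_{j,r}(n) = (r-1)·((j+1)·|Õ_{j+1,r}(n)| - j·|Õ_{j,r}(n)|)
            = (r-1)·((j+1)·|D̃_{j+1,r}(n)| - j·|D̃_{j,r}(n)|)`. -/
theorem euler_pair_beck (r : ℕ) (hr : 2 ≤ r) (S1 S2 : Set ℕ)
    (hS1 : ∀ s ∈ S1, 0 < s) (hS2 : ∀ s ∈ S2, 0 < s)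
    (hpair : IsEulerPair r S1 S2) (n j : ℕ) :
    bDifft S1 S2 j r n =
        ((r : ℤ) - 1) * (((j : ℤ) + 1) * ((setOt S1 S2 (j + 1) r n).card : ℤ) -
          (j : ℤ) * ((setOt S1 S2 j r n).card : ℤ)) ∧
      bDifft S1 S2 j r n =
        ((r : ℤ) - 1) * (((j : ℤ) + 1) * ((setDt S1 (j + 1) r n).card : ℤ) -
          (j : ℤ) * ((setDt S1 j r n).card : ℤ)) := by
  classical
  have hrS : ∀ s ∈ S1, r * s ∈ S1 := fun s hs => hpair.1 ⟨s, hs, rfl⟩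
  have hO := epb_main S1 hS1 r 1 r (one_mul r) (by omega) hrS n
  have hD := epb_main S1 hS1 r r 1 (mul_one r) (by omega) (by simp) n
  simp only [one_mul, mul_one] at hO hD
  have hN : ∀ k, ∑ p ∈ epbP S1 n, ((epbN S1 1 r p).choose k : ℤ) =
      ∑ p ∈ epbP S1 n, ((epbN S1 r 1 p).choose k : ℤ) := by
    intro k
    have a1 := hO k (fun _ => 1)
    have a2 := hD k (fun _ => 1)
    simp only [mul_one] at a1 a2
    rw [a1, a2]
  -- the difference of the length sums
  have hL : ∀ k, ∑ p ∈ epbP S1 n, ((epbN S1 1 r p).choose k : ℤ) * (numParts p : ℤ) -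
      ∑ p ∈ epbP S1 n, ((epbN S1 r 1 p).choose k : ℤ) * (numParts p : ℤ) =
      ((r : ℤ) - 1) * -((k : ℤ) * ∑ p ∈ epbP S1 n, ((epbN S1 1 r p).choose k : ℤ)) := by
    intro k
    have a1 := hO k (fun _ => 1)
    have a2 := hO k (fun m => (m : ℤ))
    have a3 := hD k (fun m => (m : ℤ))
    simp only [mul_one] at a1
    rw [a1, a2, a3, ← Finset.sum_sub_distrib, Finset.mul_sum, ← Finset.sum_neg_distrib,
      Finset.mul_sum]
    apply Finset.sum_congr rfl
    intro T _
    split_ifs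
    · generalize n - r * ∑ s ∈ T, s = m
      rw [← Finset.sum_sub_distrib, Finset.mul_sum, ← Finset.sum_neg_distrib, Finset.mul_sum]
      apply Finset.sum_congr rfl
      intro p _
      push_cast
      ring
    · simp
  have hcard : ∀ j, ((setOt S1 S2 j r n).card : ℤ) = ((setDt S1 j r n).card : ℤ) := by
    intro j
    rw [← sub_eq_zero]
    refine epb_inv (n + 1) (fun j => ((setOt S1 S2 j r n).card : ℤ) - ((setDt S1 j r n).card : ℤ))
      ?_ ?_ j
    · intro j hj
      simp only [epb_setOt r hr S1 S2 hpair, epb_setDt r hr S1]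
      rw [Finset.filter_false_of_mem, Finset.filter_false_of_mem]
      · simp
      · intro p _; have := epb_N_le S1 r 1 n p; omega
      · intro p _; have := epb_N_le S1 1 r n p; omega
    · intro k
      simp only [epb_setOt r hr S1 S2 hpair, epb_setDt r hr S1, mul_sub, Finset.sum_sub_distrib]
      have f1 := epb_fib (epbP S1 n) (epbN S1 1 r) (fun _ => 1) (n + 1) k
        (fun p _ => epb_N_le S1 1 r n p)
      have f2 := epb_fib (epbP S1 n) (epbN S1 r 1) (fun _ => 1) (n + 1) k
        (fun p _ => epb_N_le S1 r 1 n p)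
      simp only [Finset.sum_const, nsmul_eq_mul, mul_one] at f1 f2
      rw [f1, f2, hN, sub_self]
  have hmain : bDifft S1 S2 j r n =
        ((r : ℤ) - 1) * (((j : ℤ) + 1) * ((setOt S1 S2 (j + 1) r n).card : ℤ) -
          (j : ℤ) * ((setOt S1 S2 j r n).card : ℤ)) := by
    rw [← sub_eq_zero]
    refine epb_inv (n + 1) (fun j => bDifft S1 S2 j r n -
        ((r : ℤ) - 1) * (((j : ℤ) + 1) * ((setOt S1 S2 (j + 1) r n).card : ℤ) -
          (j : ℤ) * ((setOt S1 S2 j r n).card : ℤ))) ?_ ?_ j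
    · intro j hj
      simp only [bDifft, epb_setOt r hr S1 S2 hpair, epb_setDt r hr S1]
      rw [Finset.filter_false_of_mem, Finset.filter_false_of_mem, Finset.filter_false_of_mem]
      · simp
      · intro p _; have := epb_N_le S1 1 r n p; omega
      · intro p _; have := epb_N_le S1 r 1 n p; omega
      · intro p _; have := epb_N_le S1 1 r n p; omega
    · intro k
      simp only [bDifft, epb_setOt r hr S1 S2 hpair, epb_setDt r hr S1]
      have f1 := epb_fib (epbP S1 n) (epbN S1 1 r) (fun p => (numParts p : ℤ)) (n + 1) k
        (fun p _ => epb_N_le S1 1 r n p)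
      have f2 := epb_fib (epbP S1 n) (epbN S1 r 1) (fun p => (numParts p : ℤ)) (n + 1) k
        (fun p _ => epb_N_le S1 r 1 n p)
      have f3 := epb_fib2 (epbP S1 n) (epbN S1 1 r) (n + 1) k
        (fun p _ => epb_N_le S1 1 r n p)
      have h := hL k
      rw [← f1, ← f2, ← f3, Finset.mul_sum, ← Finset.sum_sub_distrib, ← sub_eq_zero,
        ← Finset.sum_sub_distrib] at h
      rw [← h]
      apply Finset.sum_congr rfl
      intro j _
      ring
  refine ⟨hmain, ?_⟩
  rw [hmain, hcard, hcard]
end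

section
/- Let r ≥ 2 be an integer and let (S₁, S₂) be an Euler pair of order r, i.e., rS₁ ⊆ S₁ and S₂ = S₁ \ rS₁. Then for all non-negative integers n and j, b̃'_{≤j,r}(n) = T̃_{j+1,r}(n), and moreover b̃'_{j,r}(n) = T̃_{j+1,r}(n) − T̃_{j,r}(n) in the integers. -/
open Finset

namespace EulerBeck

/-- weight of a multiplicity function -/
noncomputable def wt : (ℕ →₀ ℕ) →+ ℕ :=
  (Multiset.sumAddMonoidHom (M := ℕ)).comp (Finsupp.toMultiset (α := ℕ))

lemma wt_def (f : ℕ →₀ ℕ) : wt f = (Finsupp.toMultiset f).sum := rfl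

lemma wt_single (s k : ℕ) : wt (Finsupp.single s k) = k * s := by
  simp [wt_def, Finsupp.toMultiset_single, Multiset.sum_nsmul]

lemma wt_mapDomain (r : ℕ) (f : ℕ →₀ ℕ) : wt (f.mapDomain (fun s => r * s)) = r * wt f := by
  rw [wt_def, wt_def, ← Finsupp.toMultiset_map, Multiset.sum_map_mul_left]
  simp

lemma le_wt (f : ℕ →₀ ℕ) (s : ℕ) (hs : s ∈ f.support) : s ≤ wt f := by
  rw [wt_def]
  apply Multiset.single_le_sum (fun _ _ => Nat.zero_le _)
  simpa using hs

lemma wt_eq_zero (f : ℕ →₀ ℕ) (h0 : f 0 = 0) (h : wt f = 0) : f = 0 := by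
  ext s
  by_contra hs
  have hs' : s ∈ f.support := by simpa using hs
  have := le_wt f s hs'
  have : s = 0 := by omega
  subst this
  exact hs (by simpa using h0)

open scoped Classical in
/-- all multiplicity functions of weight at most n -/
noncomputable def U (n : ℕ) : Finset (ℕ →₀ ℕ) :=
  (Finset.range (n + 1)).biUnion fun k =>
    (Finset.univ : Finset (Nat.Partition k)).image fun p => Multiset.toFinsupp p.parts

lemma wt_toFinsupp (m : Multiset ℕ) : wt (Multiset.toFinsupp m) = m.sum := by
  simp [wt_def]

lemma mem_U {n : ℕ} {f : ℕ →₀ ℕ} : f ∈ U n ↔ f 0 = 0 ∧ wt f ≤ n := by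
  unfold U
  simp only [Finset.mem_biUnion, Finset.mem_range, Finset.mem_image, Finset.mem_univ, true_and]
  constructor
  · rintro ⟨k, hk, p, rfl⟩
    refine ⟨?_, ?_⟩
    · simp only [Multiset.toFinsupp_apply, Multiset.count_eq_zero]
      intro h
      exact absurd (p.parts_pos h) (lt_irrefl _)
    · rw [wt_toFinsupp, p.parts_sum]; omega
  · rintro ⟨h0, hw⟩
    refine ⟨wt f, by omega, ⟨Finsupp.toMultiset f, ?_, rfl⟩, by simp⟩
    intro i hi
    rcases Nat.eq_zero_or_pos i with rfl | h
    · exfalso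
      simp at hi
      exact hi h0
    · exact h

/-- parts in S -/
def PB (S : Set ℕ) (f : ℕ →₀ ℕ) : Prop := ∀ s ∈ f.support, s ∈ S
/-- parts in S, multiplicity less than r -/
def PF (S : Set ℕ) (r : ℕ) (f : ℕ →₀ ℕ) : Prop := ∀ s ∈ f.support, s ∈ S ∧ f s < r
/-- parts in S minus rS -/
def PG (S : Set ℕ) (r : ℕ) (f : ℕ →₀ ℕ) : Prop := ∀ s ∈ f.support, s ∈ S ∧ s ∉ rSet r S

lemma PF.pb {S r f} (h : PF S r f) : PB S f := fun s hs => (h s hs).1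
lemma PG.pb {S r f} (h : PG S r f) : PB S f := fun s hs => (h s hs).1
lemma PB.zero {S f} (h : PB S f) (hS : ∀ s ∈ S, 0 < s) : f 0 = 0 := by
  by_contra h0
  exact absurd (hS 0 (h 0 (by simpa using h0))) (lt_irrefl _)

open scoped Classical in
/-- pairs -/
noncomputable def pr (n r : ℕ) (P Q : (ℕ →₀ ℕ) → Prop) (N : ℕ) : Finset ((ℕ →₀ ℕ) × (ℕ →₀ ℕ)) :=
  ((U n) ×ˢ (U n)).filter fun p => P p.1 ∧ Q p.2 ∧ wt p.1 + r * wt p.2 = N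

open scoped Classical in
lemma sum_pr (n r : ℕ) (P Q : (ℕ →₀ ℕ) → Prop) (N : ℕ) (φ : (ℕ →₀ ℕ) × (ℕ →₀ ℕ) → ℕ) :
    ∑ p ∈ pr n r P Q N, φ p =
      ∑ b ∈ (U n).filter Q, ∑ a ∈ (U n).filter (fun a => P a ∧ wt a + r * wt b = N), φ (a, b) := by
  unfold pr
  rw [Finset.sum_filter, Finset.sum_product_right, Finset.sum_filter]
  apply Finset.sum_congr rfl
  intro b _
  rw [Finset.sum_filter]
  by_cases hb : Q b <;> simp [hb]

lemma mem_pr {S : Set ℕ} (hS : ∀ s ∈ S, 0 < s) {n r : ℕ} (hr : 2 ≤ r)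
    {P Q : (ℕ →₀ ℕ) → Prop} (hP : ∀ f, P f → PB S f) {N : ℕ} (hN : N ≤ n)
    (p : (ℕ →₀ ℕ) × (ℕ →₀ ℕ)) :
    p ∈ pr n r P (fun f => PB S f ∧ Q f) N ↔ P p.1 ∧ PB S p.2 ∧ Q p.2 ∧ wt p.1 + r * wt p.2 = N := by
  unfold pr
  simp only [Finset.mem_filter, Finset.mem_product, mem_U]
  constructor
  · tauto
  · rintro ⟨h1, h2, h3, h4⟩
    have : wt p.2 ≤ r * wt p.2 := Nat.le_mul_of_pos_left _ (by omega)
    refine ⟨⟨⟨(hP _ h1).zero hS, by omega⟩, h2.zero hS, by omega⟩, h1, ⟨h2, h3⟩, h4⟩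

/-- quotient of multiplicities -/
noncomputable def qt (r : ℕ) (f : ℕ →₀ ℕ) : ℕ →₀ ℕ := f.mapRange (fun m => m / r) (by simp)
/-- remainder of multiplicities -/
noncomputable def rm (r : ℕ) (f : ℕ →₀ ℕ) : ℕ →₀ ℕ := f.mapRange (fun m => m % r) (by simp)

lemma qt_apply (r : ℕ) (f : ℕ →₀ ℕ) (s : ℕ) : qt r f s = f s / r := rfl
lemma rm_apply (r : ℕ) (f : ℕ →₀ ℕ) (s : ℕ) : rm r f s = f s % r := rfl

lemma rm_add_qt (r : ℕ) (f : ℕ →₀ ℕ) : rm r f + r • qt r f = f := by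
  ext s; simp [rm_apply, qt_apply, Nat.mod_add_div]

lemma PF.lt {S r f} (hr : 2 ≤ r) (h : PF S r f) (s : ℕ) : f s < r := by
  by_cases hs : s ∈ f.support
  · exact (h s hs).2
  · have : f s = 0 := by simpa using hs
    omega

lemma qt_add {S r a} (hr : 2 ≤ r) (h : PF S r a) (b : ℕ →₀ ℕ) : qt r (a + r • b) = b := by
  ext s
  have := h.lt hr s
  simp [qt_apply, Nat.add_mul_div_left _ _ (show 0 < r by omega), Nat.div_eq_of_lt this]

lemma rm_add {S r a} (hr : 2 ≤ r) (h : PF S r a) (b : ℕ →₀ ℕ) : rm r (a + r • b) = a := by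
  ext s
  have := h.lt hr s
  simp [rm_apply, Nat.mod_eq_of_lt this]

open scoped Classical in
lemma Dbij {S : Set ℕ} (hS : ∀ s ∈ S, 0 < s) {n r : ℕ} (hr : 2 ≤ r)
    {Q : (ℕ →₀ ℕ) → Prop} {N : ℕ} (hN : N ≤ n) (φ : (ℕ →₀ ℕ) → ℕ) :
    ∑ f ∈ (U n).filter (fun f => PB S f ∧ Q (qt r f) ∧ wt f = N), φ f =
    ∑ p ∈ pr n r (PF S r) (fun f => PB S f ∧ Q f) N, φ (p.1 + r • p.2) := by
  symm
  refine Finset.sum_bij' (fun p _ => p.1 + r • p.2) (fun f _ => (rm r f, qt r f)) ?_ ?_ ?_ ?_ ?_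
  · intro p hp
    rw [mem_pr hS hr (fun f hf => hf.pb) hN] at hp
    obtain ⟨h1, h2, h3, h4⟩ := hp
    have hpb : PB S (p.1 + r • p.2) := by
      intro s hs
      rcases Finset.mem_union.1 (Finsupp.support_add hs) with h | h
      · exact h1.pb s h
      · exact h2 s (Finsupp.support_smul h)
    have hw : wt (p.1 + r • p.2) = N := by simp [h4]
    simp only [Finset.mem_filter, mem_U]
    refine ⟨⟨hpb.zero hS, by omega⟩, hpb, ?_, hw⟩
    rw [qt_add hr h1]; exact h3
  · intro f hf
    simp only [Finset.mem_filter, mem_U] at hf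
    obtain ⟨_, h1, h2, h3⟩ := hf
    rw [mem_pr hS hr (fun f hf => hf.pb) hN]
    refine ⟨?_, ?_, h2, ?_⟩
    · intro s hs
      simp [rm_apply] at hs ⊢
      refine ⟨h1 s ?_, Nat.mod_lt _ (by omega)⟩
      simp only [Finsupp.mem_support_iff]
      intro h; simp [h] at hs
    · intro s hs
      simp [qt_apply] at hs
      apply h1 s
      simp only [Finsupp.mem_support_iff]
      intro h; omega
    · rw [← h3]
      conv_rhs => rw [← rm_add_qt r f]
      simp
  · intro p hp
    rw [mem_pr hS hr (fun f hf => hf.pb) hN] at hp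
    ext1
    · exact rm_add hr hp.1 _
    · exact qt_add hr hp.1 _
  · intro f _
    exact rm_add_qt r f
  · intros; rfl

lemma inj_mul {r : ℕ} (hr : 2 ≤ r) : Function.Injective (fun s : ℕ => r * s) :=
  fun a b h => Nat.eq_of_mul_eq_mul_left (by omega) h

open scoped Classical in
/-- part in rS, scaled down -/
noncomputable def dn (r : ℕ) (hr : 2 ≤ r) (S : Set ℕ) (f : ℕ →₀ ℕ) : ℕ →₀ ℕ :=
  (f.filter (fun i => i ∈ rSet r S)).comapDomain (fun s => r * s) (inj_mul hr).injOn

/-- scale up -/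
noncomputable def up (r : ℕ) (f : ℕ →₀ ℕ) : ℕ →₀ ℕ := f.mapDomain (fun s => r * s)

lemma up_apply {r : ℕ} (hr : 2 ≤ r) (f : ℕ →₀ ℕ) (s : ℕ) : up r f (r * s) = f s :=
  Finsupp.mapDomain_apply (inj_mul hr) f s

lemma up_support {r : ℕ} (hr : 2 ≤ r) (f : ℕ →₀ ℕ) :
    (up r f).support = f.support.image (fun s => r * s) :=
  Finsupp.mapDomain_support_of_injective (inj_mul hr) f

lemma mem_rSet {r : ℕ} (hr : 2 ≤ r) {S : Set ℕ} {s : ℕ} : r * s ∈ rSet r S ↔ s ∈ S :=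
  (inj_mul hr).mem_set_image

lemma up_apply_not {r : ℕ} (hr : 2 ≤ r) {S : Set ℕ} {f : ℕ →₀ ℕ} (h : PB S f) (s : ℕ)
    (hs : s ∉ rSet r S) : up r f s = 0 := by
  by_contra hh
  have : s ∈ (up r f).support := by simpa using hh
  rw [up_support hr] at this
  obtain ⟨t, ht, rfl⟩ := Finset.mem_image.1 this
  exact hs ((mem_rSet hr).2 (h t ht))

lemma PG.apply {S r f} (h : PG S r f) (s : ℕ) (hs : s ∈ rSet r S) : f s = 0 := by
  by_contra hh
  exact (h s (by simpa using hh)).2 hs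

lemma dn_apply {r : ℕ} (hr : 2 ≤ r) (S : Set ℕ) (f : ℕ →₀ ℕ) (s : ℕ) (hs : s ∈ S) :
    dn r hr S f s = f (r * s) := by
  simp [dn, Finsupp.comapDomain_apply, mem_rSet hr, hs]

lemma dn_apply_not {r : ℕ} (hr : 2 ≤ r) (S : Set ℕ) (f : ℕ →₀ ℕ) (s : ℕ) (hs : s ∉ S) :
    dn r hr S f s = 0 := by
  simp [dn, Finsupp.comapDomain_apply, mem_rSet hr, hs]

lemma dn_pb {r : ℕ} (hr : 2 ≤ r) (S : Set ℕ) (f : ℕ →₀ ℕ) : PB S (dn r hr S f) := by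
  intro s hs
  by_contra h
  simp [dn_apply_not hr S f s h] at hs

open scoped Classical in
lemma filter_add_up {r : ℕ} (hr : 2 ≤ r) (S : Set ℕ) (f : ℕ →₀ ℕ) :
    f.filter (fun i => i ∉ rSet r S) + up r (dn r hr S f) = f := by
  ext s
  rw [Finsupp.add_apply, Finsupp.filter_apply]
  by_cases hs : s ∈ rSet r S
  · obtain ⟨t, ht, rfl⟩ := id hs
    simp only [hs, not_true, if_false, zero_add]
    change up r _ (r * t) = f (r * t)
    rw [up_apply hr, dn_apply hr S f t ht]
  · simp [hs, up_apply_not hr (dn_pb hr S f) s hs]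

lemma dn_add {S : Set ℕ} {r : ℕ} {a b : ℕ →₀ ℕ} (hr : 2 ≤ r) (h : PG S r a) (hb : PB S b) :
    dn r hr S (a + up r b) = b := by
  ext s
  by_cases hs : s ∈ S
  · rw [dn_apply hr S _ s hs, Finsupp.add_apply, h.apply _ ((mem_rSet hr).2 hs), up_apply hr, zero_add]
  · rw [dn_apply_not hr S _ s hs]
    by_contra hh
    exact hs (hb s (by simpa using Ne.symm hh))

open scoped Classical in
lemma filter_add {S : Set ℕ} {r : ℕ} {a b : ℕ →₀ ℕ} (hr : 2 ≤ r) (h : PG S r a) (hb : PB S b) :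
    (a + up r b).filter (fun i => i ∉ rSet r S) = a := by
  ext s
  rw [Finsupp.filter_apply, Finsupp.add_apply]
  by_cases hs : s ∈ rSet r S
  · simp [hs, h.apply s hs]
  · simp [hs, up_apply_not hr hb s hs]

lemma wt_up (r : ℕ) (f : ℕ →₀ ℕ) : wt (up r f) = r * wt f := wt_mapDomain r f

open scoped Classical in
lemma Obij {S : Set ℕ} (hS : ∀ s ∈ S, 0 < s) {n r : ℕ} (hr : 2 ≤ r) (hsub : rSet r S ⊆ S)
    {Q : (ℕ →₀ ℕ) → Prop} {N : ℕ} (hN : N ≤ n) (φ : (ℕ →₀ ℕ) → ℕ) :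
    ∑ f ∈ (U n).filter (fun f => PB S f ∧ Q (dn r hr S f) ∧ wt f = N), φ f =
    ∑ p ∈ pr n r (PG S r) (fun f => PB S f ∧ Q f) N, φ (p.1 + up r p.2) := by
  symm
  refine Finset.sum_bij' (fun p _ => p.1 + up r p.2)
    (fun f _ => (f.filter (fun i => i ∉ rSet r S), dn r hr S f)) ?_ ?_ ?_ ?_ ?_
  · intro p hp
    rw [mem_pr hS hr (fun f hf => hf.pb) hN] at hp
    obtain ⟨h1, h2, h3, h4⟩ := hp
    have hpb : PB S (p.1 + up r p.2) := by
      intro s hs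
      rcases Finset.mem_union.1 (Finsupp.support_add hs) with h | h
      · exact h1.pb s h
      · rw [up_support hr] at h
        obtain ⟨t, ht, rfl⟩ := Finset.mem_image.1 h
        exact hsub ((mem_rSet hr).2 (h2 t ht))
    have hw : wt (p.1 + up r p.2) = N := by simp [h4, wt_up]
    simp only [Finset.mem_filter, mem_U]
    refine ⟨⟨hpb.zero hS, by omega⟩, hpb, ?_, hw⟩
    rw [dn_add hr h1 h2]; exact h3
  · intro f hf
    simp only [Finset.mem_filter, mem_U] at hf
    obtain ⟨_, h1, h2, h3⟩ := hf
    rw [mem_pr hS hr (fun f hf => hf.pb) hN]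
    refine ⟨?_, dn_pb hr S f, h2, ?_⟩
    · intro s hs
      simp only [Finsupp.support_filter, Finset.mem_filter] at hs
      exact ⟨h1 s hs.1, hs.2⟩
    · rw [← h3]
      conv_rhs => rw [← filter_add_up hr S f]
      simp [wt_up]
  · intro p hp
    rw [mem_pr hS hr (fun f hf => hf.pb) hN] at hp
    ext1
    · exact filter_add hr hp.1 hp.2.1
    · exact dn_add hr hp.1 hp.2.1
  · intro f _
    exact filter_add_up hr S f
  · intros; rfl

open scoped Classical in
/-- count with offset -/
noncomputable def C (n : ℕ) (P : (ℕ →₀ ℕ) → Prop) (k N : ℕ) : ℕ :=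
  ((U n).filter (fun a => P a ∧ wt a + k = N)).card

lemma C_eq (n : ℕ) (P : (ℕ →₀ ℕ) → Prop) (k N : ℕ) (h : k ≤ N) : C n P k N = C n P 0 (N - k) := by
  classical
  unfold C
  congr 1
  ext a
  simp only [Finset.mem_filter]
  refine and_congr_right fun _ => and_congr_right fun _ => by omega

lemma C_lt (n : ℕ) (P : (ℕ →₀ ℕ) → Prop) (k N : ℕ) (h : N < k) : C n P k N = 0 := by
  classical
  unfold C
  rw [Finset.card_eq_zero, Finset.filter_eq_empty_iff]
  intro a _ ⟨_, h⟩
  omega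

lemma glaisher0 {S : Set ℕ} (hS : ∀ s ∈ S, 0 < s) {n r : ℕ} (hr : 2 ≤ r) (hsub : rSet r S ⊆ S)
    (N : ℕ) (hN : N ≤ n) : C n (PF S r) 0 N = C n (PG S r) 0 N := by
  classical
  induction N using Nat.strong_induction_on with
  | _ N ih =>
    have h1 := Dbij hS hr (Q := fun _ => True) hN (fun _ => 1)
    have h2 := Obij hS hr hsub (Q := fun _ => True) hN (fun _ => 1)
    have h3 := h1.symm.trans h2
    rw [sum_pr, sum_pr] at h3
    simp only [Finset.sum_const, smul_eq_mul, mul_one] at h3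
    change ∑ b ∈ _, C n (PF S r) (r * wt b) N = ∑ b ∈ _, C n (PG S r) (r * wt b) N at h3
    have key : ∀ B : Finset (ℕ →₀ ℕ), (∀ b ∈ B, b 0 = 0) → 0 ∈ B →
        ∑ b ∈ B, C n (PF S r) (r * wt b) N = ∑ b ∈ B, C n (PG S r) (r * wt b) N →
        C n (PF S r) 0 N = C n (PG S r) 0 N := by
      intro B hB hz h3
      rw [← Finset.add_sum_erase _ _ hz, ← Finset.add_sum_erase _ _ hz] at h3
      simp only [map_zero, mul_zero] at h3
      have h4 : ∑ b ∈ B.erase 0, C n (PF S r) (r * wt b) N =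
         ∑ b ∈ B.erase 0, C n (PG S r) (r * wt b) N := by
        apply Finset.sum_congr rfl
        intro b hb
        simp only [Finset.mem_erase] at hb
        have hw : 0 < r * wt b := by
          apply Nat.mul_pos (by omega)
          by_contra hh
          exact hb.1 (wt_eq_zero b (hB b hb.2) (by omega))
        rcases le_or_gt (r * wt b) N with h | h
        · rw [C_eq _ _ _ _ h, C_eq _ _ _ _ h]
          exact ih _ (by omega) (by omega)
        · rw [C_lt _ _ _ _ h, C_lt _ _ _ _ h]
      omega
    refine key _ ?_ ?_ h3
    · intro b hb
      simp only [Finset.mem_filter, mem_U] at hb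
      exact hb.1.1
    · simp [mem_U, PB]

lemma glaisher {S : Set ℕ} (hS : ∀ s ∈ S, 0 < s) {n r : ℕ} (hr : 2 ≤ r) (hsub : rSet r S ⊆ S)
    (k N : ℕ) (hN : N ≤ n) : C n (PF S r) k N = C n (PG S r) k N := by
  rcases le_or_gt k N with h | h
  · rw [C_eq _ _ _ _ h, C_eq _ _ _ _ h]
    exact glaisher0 hS hr hsub _ (by omega)
  · rw [C_lt _ _ _ _ h, C_lt _ _ _ _ h]

lemma shift {n s m : ℕ} (hs : 0 < s) (P P' : (ℕ →₀ ℕ) → Prop) [DecidablePred P] [DecidablePred P']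
    (h1 : ∀ a, a 0 = 0 → P a → P' (a + Finsupp.single s m) ∧ wt a + m * s ≤ n)
    (h2 : ∀ a, a 0 = 0 → P' (a + Finsupp.single s m) → P a)
    (h3 : ∀ a, a 0 = 0 → P' a → m ≤ a s) :
    ((U n).filter P).card = ((U n).filter P').card := by
  refine Finset.card_bij (fun a _ => a + Finsupp.single s m) ?_ ?_ ?_
  · intro a ha
    simp only [Finset.mem_filter, mem_U] at ha ⊢
    have := h1 a ha.1.1 ha.2
    refine ⟨⟨?_, ?_⟩, this.1⟩
    · simp [ha.1.1, hs.ne']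
    · simpa [wt_single] using this.2
  · intro a _ b _ h
    exact add_right_cancel h
  · intro b hb
    simp only [Finset.mem_filter, mem_U] at hb
    obtain ⟨⟨hb0, hbn⟩, hb⟩ := hb
    have h := h3 b hb0 hb
    have he : (b - Finsupp.single s m) + Finsupp.single s m = b := by
      ext t
      by_cases ht : t = s
      · subst ht; simp; omega
      · simp [Ne.symm ht]
    have h0 : (b - Finsupp.single s m) 0 = 0 := by simp [hb0]
    refine ⟨b - Finsupp.single s m, ?_, he⟩
    simp only [Finset.mem_filter, mem_U]
    refine ⟨⟨h0, ?_⟩, h2 _ h0 (by rw [he]; exact hb)⟩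
    have : wt ((b - Finsupp.single s m) + Finsupp.single s m) = wt b := by rw [he]
    rw [map_add] at this
    omega

lemma C_shift {n s m k N : ℕ} (hs : 0 < s) (hN : N ≤ n) (P P' : (ℕ →₀ ℕ) → Prop)
    (h1 : ∀ a, P a ↔ P' (a + Finsupp.single s m))
    (h3 : ∀ a, P' a → m ≤ a s) :
    C n P (m * s + k) N = C n P' k N := by
  classical
  unfold C
  apply shift (n := n) (s := s) (m := m) hs (fun a => P a ∧ wt a + (m * s + k) = N)
    (fun a => P' a ∧ wt a + k = N)
  · rintro a _ ⟨ha, hw⟩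
    refine ⟨⟨(h1 a).1 ha, ?_⟩, by omega⟩
    rw [map_add, wt_single]; omega
  · rintro a _ ⟨ha, hw⟩
    refine ⟨(h1 a).2 ha, ?_⟩
    rw [map_add, wt_single] at hw; omega
  · rintro a _ ⟨ha, _⟩
    exact h3 a ha

lemma C_split (n : ℕ) (P E : (ℕ →₀ ℕ) → Prop) (k N : ℕ) :
    C n P k N = C n (fun a => P a ∧ E a) k N + C n (fun a => P a ∧ ¬ E a) k N := by
  classical
  unfold C
  rw [← Finset.card_filter_add_card_filter_not (s := (U n).filter (fun a => P a ∧ wt a + k = N)) E]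
  rw [Finset.filter_filter, Finset.filter_filter]
  congr 2 <;> (ext a; simp only [Finset.mem_filter]; tauto)

lemma C_congr (n : ℕ) (P P' : (ℕ →₀ ℕ) → Prop) (k N : ℕ) (h : ∀ a, P a ↔ P' a) :
    C n P k N = C n P' k N := by
  have : P = P' := funext fun a => propext (h a)
  rw [this]

lemma C_eq_zero (n : ℕ) (P : (ℕ →₀ ℕ) → Prop) (k N : ℕ) (h : ∀ a, ¬ P a) : C n P k N = 0 := by
  classical
  unfold C
  rw [Finset.card_eq_zero, Finset.filter_eq_empty_iff]
  rintro a _ ⟨h1, _⟩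
  exact h a h1

lemma PB_iff (S : Set ℕ) (f : ℕ →₀ ℕ) : PB S f ↔ ∀ s, f s ≠ 0 → s ∈ S := by
  simp [PB]
lemma PF_iff (S : Set ℕ) (r : ℕ) (f : ℕ →₀ ℕ) :
    PF S r f ↔ ∀ s, f s ≠ 0 → s ∈ S ∧ f s < r := by
  simp [PF]
lemma PG_iff (S : Set ℕ) (r : ℕ) (f : ℕ →₀ ℕ) :
    PG S r f ↔ ∀ s, f s ≠ 0 → s ∈ S ∧ s ∉ rSet r S := by
  simp [PG]

lemma add_single_apply (a : ℕ →₀ ℕ) (s m t : ℕ) :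
    (a + Finsupp.single s m) t = if t = s then a s + m else a t := by
  by_cases h : t = s
  · subst h; simp
  · simp [h]

lemma G_step {S : Set ℕ} {n r s k N : ℕ} (hs : 0 < s) (hsS : s ∈ S) (hN : N ≤ n) 
    (hsr : s ∉ rSet r S) :
    C n (fun a => PG S r a ∧ a s ≠ 0) k N = C n (PG S r) (s + k) N := by
  rw [← C_shift (m := 1) hs hN (PG S r) (fun a => PG S r a ∧ a s ≠ 0), one_mul]
  · intro a
    simp only [PG_iff, add_single_apply]
    grind
  · intro a ha
    have := ha.2
    omega

lemma F_step {S : Set ℕ} {n r s k N : ℕ} (hr : 2 ≤ r) (hs : 0 < s) (hsS : s ∈ S) (hN : N ≤ n) :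
    C n (fun a => PF S r a ∧ a s ≠ 0) k N + C n (PF S r) (r * s + k) N =
    C n (PF S r) (s + k) N + C n (fun a => PF S r a ∧ a s ≠ 0) (r * s + k) N := by
  rw [C_split n (PF S r) (fun a => a s ≠ 0) (r * s + k),
    C_split n (PF S r) (fun a => a s = r - 1) (s + k)]
  have e1 : C n (fun a => PF S r a ∧ ¬ (a s = r - 1)) (1 * s + k) N =
      C n (fun a => PF S r a ∧ a s ≠ 0) k N := by
    apply C_shift hs hN
    · intro a
      simp only [PF_iff, add_single_apply]
      constructor
      · rintro ⟨h1, h2⟩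
        have := h1 s
        grind
      · rintro ⟨h1, h2⟩
        refine ⟨fun t ht => ?_, ?_⟩
        · have := h1 t
          grind
        · have := h1 s
          grind
    · intro a ha
      have := ha.2
      omega
  have e2 : C n (fun a => PF S r a ∧ ¬ (a s ≠ 0)) ((r - 1) * s + (s + k)) N =
      C n (fun a => PF S r a ∧ a s = r - 1) (s + k) N := by
    apply C_shift hs hN
    · intro a
      simp only [PF_iff, add_single_apply]
      constructor
      · rintro ⟨h1, h2⟩
        refine ⟨fun t ht => ?_, by grind⟩
        have := h1 t
        grind
      · rintro ⟨h1, h2⟩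
        refine ⟨fun t ht => ?_, by grind⟩
        have := h1 t
        grind
    · intro a ha
      have := ha.2
      omega
  have e3 : (r - 1) * s + (s + k) = r * s + k := by
    obtain ⟨q, rfl⟩ : ∃ q, r = q + 1 := ⟨r - 1, by omega⟩
    simp; ring
  rw [e3] at e2
  rw [one_mul] at e1
  omega

open scoped Classical in
/-- allowed parts up to n -/
noncomputable def R (S : Set ℕ) (n : ℕ) : Finset ℕ := (Finset.range (n + 1)).filter (fun s => s ∈ S)

lemma mem_R {S : Set ℕ} {n s : ℕ} : s ∈ R S n ↔ s ≤ n ∧ s ∈ S := by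
  simp [R]

open scoped Classical in
lemma card_support {S : Set ℕ} {n : ℕ} {a : ℕ →₀ ℕ} (h : PB S a) (hw : wt a ≤ n) :
    a.support.card = ∑ s ∈ R S n, if a s ≠ 0 then 1 else 0 := by
  rw [← Finset.card_filter]
  congr 1
  ext s
  simp only [Finset.mem_filter, mem_R]
  constructor
  · intro hs
    exact ⟨⟨(le_wt a s hs).trans hw, h s hs⟩, by simpa using hs⟩
  · intro hs; simpa using hs.2

open scoped Classical in
lemma sum_card {S : Set ℕ} {n k N : ℕ} (hN : N ≤ n) (P : (ℕ →₀ ℕ) → Prop) (hP : ∀ a, P a → PB S a) :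
    ∑ a ∈ (U n).filter (fun a => P a ∧ wt a + k = N), a.support.card =
    ∑ s ∈ R S n, C n (fun a => P a ∧ a s ≠ 0) k N := by
  rw [Finset.sum_congr rfl (fun a ha => card_support (S := S) (n := n) (hP a ?_) ?_)]
  · rw [Finset.sum_comm]
    apply Finset.sum_congr rfl
    intro s _
    rw [← Finset.card_filter, Finset.filter_filter]
    unfold C
    congr 1
    ext a
    simp only [Finset.mem_filter]
    tauto
  · simp only [Finset.mem_filter] at ha; exact ha.2.1
  · simp only [Finset.mem_filter] at ha; omega

open scoped Classical in
lemma R_sum {S : Set ℕ} {n r k N : ℕ} (hr : 2 ≤ r) (hsub : rSet r S ⊆ S) (hN : N ≤ n)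
    (P : (ℕ →₀ ℕ) → Prop) :
    ∑ s ∈ R S n, C n P (s + k) N =
      ∑ s ∈ R S n, (if s ∈ rSet r S then 0 else C n P (s + k) N) +
      ∑ s ∈ R S n, C n P (r * s + k) N := by
  have e : ∀ s ∈ R S n, C n P (s + k) N = (if s ∈ rSet r S then 0 else C n P (s + k) N) +
      (if s ∈ rSet r S then C n P (s + k) N else 0) := by
    intro s _; split_ifs <;> simp
  rw [Finset.sum_congr rfl e, Finset.sum_add_distrib]
  congr 1
  rw [← Finset.sum_filter]
  have e2 : ∑ s ∈ (R S n).filter (fun s => r * s ≤ n), C n P (r * s + k) N =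
      ∑ s ∈ R S n, C n P (r * s + k) N := by
    apply Finset.sum_filter_of_ne
    intro s _ h
    by_contra hh
    exact h (C_lt _ _ _ _ (by omega))
  rw [← e2]
  symm
  refine Finset.sum_bij (fun s _ => r * s) ?_ ?_ ?_ ?_
  · intro s hs
    simp only [Finset.mem_filter, mem_R] at hs ⊢
    have := (mem_rSet hr).2 hs.1.2
    exact ⟨⟨hs.2, hsub this⟩, this⟩
  · intro s _ t _ h
    exact inj_mul hr h
  · intro t ht
    simp only [Finset.mem_filter, mem_R] at ht
    obtain ⟨⟨h1, h2⟩, s, hs, rfl⟩ := ht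
    refine ⟨s, ?_, rfl⟩
    simp only [Finset.mem_filter, mem_R]
    have : s ≤ r * s := Nat.le_mul_of_pos_left _ (by omega)
    exact ⟨⟨by simp only at h1; omega, hs⟩, h1⟩
  · intros; rfl

open scoped Classical in
lemma base_beck {S : Set ℕ} (hS : ∀ s ∈ S, 0 < s) {n r k N : ℕ} (hr : 2 ≤ r)
    (hsub : rSet r S ⊆ S) (hN : N ≤ n) :
    ∑ a ∈ (U n).filter (fun a => PF S r a ∧ wt a + k = N), a.support.card =
    ∑ a ∈ (U n).filter (fun a => PG S r a ∧ wt a + k = N), a.support.card +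
    ∑ s ∈ R S n, C n (fun a => PF S r a ∧ a s ≠ 0) (r * s + k) N := by
  rw [sum_card hN _ (fun a (h : PF S r a) => h.pb), sum_card hN _ (fun a (h : PG S r a) => h.pb)]
  have e1 : ∑ s ∈ R S n, C n (fun a => PG S r a ∧ a s ≠ 0) k N =
      ∑ s ∈ R S n, (if s ∈ rSet r S then 0 else C n (PF S r) (s + k) N) := by
    apply Finset.sum_congr rfl
    intro s hs
    rw [mem_R] at hs
    split_ifs with h
    · apply C_eq_zero
      rintro a ⟨h1, h2⟩
      exact h2 (h1.apply s h)
    · rw [G_step (hS s hs.2) hs.2 hN h, glaisher hS hr hsub _ _ hN]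
  have e2 : ∑ s ∈ R S n, (C n (fun a => PF S r a ∧ a s ≠ 0) k N + C n (PF S r) (r * s + k) N) =
     ∑ s ∈ R S n, (C n (PF S r) (s + k) N + C n (fun a => PF S r a ∧ a s ≠ 0) (r * s + k) N) := by
    apply Finset.sum_congr rfl
    intro s hs
    rw [mem_R] at hs
    exact F_step hr (hS s hs.2) hs.2 hN
  rw [Finset.sum_add_distrib, Finset.sum_add_distrib, R_sum hr hsub hN] at e2
  omega

lemma card_supp_add_single (b : ℕ →₀ ℕ) (s : ℕ) :
    (b + Finsupp.single s 1).support.card = b.support.card + if b s = 0 then 1 else 0 := by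
  classical
  have : (b + Finsupp.single s 1).support = insert s b.support := by
    ext t
    simp only [Finsupp.mem_support_iff, add_single_apply, Finset.mem_insert]
    grind
  rw [this]
  split_ifs with h
  · rw [Finset.card_insert_of_notMem (by simpa using h)]
  · rw [Finset.insert_eq_of_mem (by simpa using h), add_zero]

open scoped Classical in
lemma inner_step {S : Set ℕ} {n r s j w : ℕ} (hr : 2 ≤ r) (hs : 0 < s) (hsS : s ∈ S) :
    ((U n).filter (fun b => (PB S b ∧ b.support.card = j) ∧ w + (r * s + r * wt b) = n)).card =
    ((U n).filter (fun b => (PB S b ∧ b.support.card = j + 1) ∧ w + r * wt b = n ∧ b s = 1)).card +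
    ((U n).filter (fun b => (PB S b ∧ b.support.card = j) ∧ w + r * wt b = n ∧ 2 ≤ b s)).card := by
  rw [← Finset.card_filter_add_card_filter_not (s := (U n).filter
    (fun b => (PB S b ∧ b.support.card = j) ∧ w + (r * s + r * wt b) = n)) (fun b => b s = 0)]
  rw [Finset.filter_filter, Finset.filter_filter]
  have hpb : ∀ b, PB S b ↔ PB S (b + Finsupp.single s 1) := by
    intro b
    simp only [PB_iff, add_single_apply]
    grind
  have hle : ∀ b, w + (r * s + r * wt b) = n → wt b + 1 * s ≤ n := by
    intro b hb
    have h1 : s ≤ r * s := Nat.le_mul_of_pos_left _ (by omega)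
    have h2 : wt b ≤ r * wt b := Nat.le_mul_of_pos_left _ (by omega)
    omega
  have hw : ∀ b, r * wt (b + Finsupp.single s 1) = r * s + r * wt b := by
    intro b
    rw [map_add, wt_single]; ring
  congr 1
  · apply shift (s := s) (m := 1) hs
    · rintro b _ ⟨⟨⟨h1, h2⟩, h3⟩, h4⟩
      refine ⟨⟨⟨(hpb b).1 h1, ?_⟩, ?_, ?_⟩, hle b h3⟩
      · rw [card_supp_add_single, if_pos h4, h2]
      · rw [hw]; exact h3
      · simp [h4]
    · rintro b _ ⟨⟨h1, h2⟩, h3, h4⟩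
      have h4' : b s = 0 := by simpa using h4
      rw [card_supp_add_single, if_pos h4'] at h2
      rw [hw] at h3
      exact ⟨⟨⟨(hpb b).2 h1, by omega⟩, h3⟩, h4'⟩
    · rintro b _ ⟨_, _, h⟩
      omega
  · apply shift (s := s) (m := 1) hs
    · rintro b _ ⟨⟨⟨h1, h2⟩, h3⟩, h4⟩
      refine ⟨⟨⟨(hpb b).1 h1, ?_⟩, ?_, ?_⟩, hle b h3⟩
      · rw [card_supp_add_single, if_neg h4, h2, add_zero]
      · rw [hw]; exact h3
      · simp; omega
    · rintro b _ ⟨⟨h1, h2⟩, h3, h4⟩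
      have h4' : b s ≠ 0 := by simp at h4; omega
      rw [card_supp_add_single, if_neg h4'] at h2
      rw [hw] at h3
      exact ⟨⟨⟨(hpb b).2 h1, by omega⟩, h3⟩, h4'⟩
    · rintro b _ ⟨_, _, h⟩
      omega

open scoped Classical in
/-- count of s with a prescribed quotient property, summed over pairs -/
noncomputable def TT (S : Set ℕ) (n r j : ℕ) (E : ℕ → Prop) : ℕ :=
  ∑ p ∈ pr n r (PF S r) (fun b => PB S b ∧ b.support.card = j) n,
    ∑ s ∈ R S n, if p.1 s ≠ 0 ∧ E (p.2 s) then 1 else 0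

open scoped Classical in
lemma TT_eq (S : Set ℕ) (n r j : ℕ) (E : ℕ → Prop) :
    TT S n r j E = ∑ s ∈ R S n, ∑ a ∈ (U n).filter (fun a => PF S r a ∧ a s ≠ 0),
      ((U n).filter (fun b => (PB S b ∧ b.support.card = j) ∧ wt a + r * wt b = n ∧ E (b s))).card := by
  unfold TT
  rw [Finset.sum_comm]
  apply Finset.sum_congr rfl
  intro s _
  unfold pr
  rw [Finset.sum_filter, Finset.sum_product, Finset.sum_filter]
  apply Finset.sum_congr rfl
  intro a _
  rw [Finset.card_filter]
  by_cases ha : PF S r a ∧ a s ≠ 0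
  · rw [if_pos ha]
    apply Finset.sum_congr rfl
    intro b _
    by_cases h1 : PB S b ∧ b.support.card = j <;> by_cases h2 : wt a + r * wt b = n <;>
      by_cases h3 : E (b s) <;> simp [ha.1, ha.2, h1, h2, h3]
  · rw [if_neg ha]
    apply Finset.sum_eq_zero
    intro b _
    split_ifs <;> first | rfl | (exfalso; tauto)

open scoped Classical in
lemma key {S : Set ℕ} (hS : ∀ s ∈ S, 0 < s) {n r j : ℕ} (hr : 2 ≤ r) :
    ∑ b ∈ (U n).filter (fun b => PB S b ∧ b.support.card = j),
      ∑ s ∈ R S n, C n (fun a => PF S r a ∧ a s ≠ 0) (r * s + r * wt b) n =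
    TT S n r (j + 1) (fun m => m = 1) + TT S n r j (fun m => 2 ≤ m) := by
  rw [TT_eq, TT_eq, ← Finset.sum_add_distrib, Finset.sum_comm]
  apply Finset.sum_congr rfl
  intro s hs
  rw [mem_R] at hs
  rw [← Finset.sum_add_distrib]
  trans ∑ a ∈ (U n).filter (fun a => PF S r a ∧ a s ≠ 0), ((U n).filter
    (fun b => (PB S b ∧ b.support.card = j) ∧ wt a + (r * s + r * wt b) = n)).card
  swap
  · apply Finset.sum_congr rfl
    intro a _
    convert inner_step (w := wt a) hr (hS s hs.2) hs.2
  unfold C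
  simp only [Finset.card_filter, Finset.sum_filter]
  have e : ∀ b ∈ U n, (if PB S b ∧ b.support.card = j then
      ∑ a ∈ U n, (if (PF S r a ∧ a s ≠ 0) ∧ wt a + (r * s + r * wt b) = n then 1 else 0) else 0) =
      ∑ a ∈ U n, (if (PF S r a ∧ a s ≠ 0) ∧ (PB S b ∧ b.support.card = j) ∧
        wt a + (r * s + r * wt b) = n then 1 else 0) := by
    intro b _
    by_cases h : PB S b ∧ b.support.card = j <;> simp [h]
  rw [Finset.sum_congr rfl e, Finset.sum_comm]
  apply Finset.sum_congr rfl
  intro a _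
  by_cases h : PF S r a ∧ a s ≠ 0 <;> simp [h]

open scoped Classical in
lemma pair_card {S : Set ℕ} {n r : ℕ} (hr : 2 ≤ r) {a b : ℕ →₀ ℕ} (ha : PF S r a) (hb : PB S b)
    (hw : wt a + r * wt b = n) :
    (a + r • b).support.card + (∑ s ∈ R S n, if a s ≠ 0 ∧ b s = 1 then 1 else 0) +
      (∑ s ∈ R S n, if a s ≠ 0 ∧ 2 ≤ b s then 1 else 0) = a.support.card + b.support.card := by
  have hpb : PB S (a + r • b) := by
    intro s hs
    rcases Finset.mem_union.1 (Finsupp.support_add hs) with h | h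
    · exact ha.pb s h
    · exact hb s (Finsupp.support_smul h)
  have h2 : wt b ≤ r * wt b := Nat.le_mul_of_pos_left _ (by omega)
  rw [card_support (n := n) hpb (by simp [hw]), card_support (n := n) ha.pb (by omega),
    card_support (n := n) hb (by omega)]
  simp only [← Finset.sum_add_distrib]
  apply Finset.sum_congr rfl
  intro s _
  simp only [Finsupp.add_apply, Finsupp.smul_apply, smul_eq_mul]
  by_cases h1 : a s = 0
  · by_cases h3 : b s = 0
    · simp [h1, h3]
    · have : r ≠ 0 := by omega
      simp [h1, h3, this]
  · by_cases h3 : b s = 0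
    · simp [h1, h3]
    · by_cases h4 : b s = 1
      · simp [h1, h4]
      · have : 2 ≤ b s := by omega
        simp [h1, h3, h4, this]

lemma up_card {S : Set ℕ} {r : ℕ} (hr : 2 ≤ r) {a b : ℕ →₀ ℕ} (ha : PG S r a) (hb : PB S b) :
    (a + up r b).support.card = a.support.card + b.support.card := by
  classical
  have hd : Disjoint a.support (up r b).support := by
    rw [Finset.disjoint_left]
    intro s hs hs'
    by_cases h : s ∈ rSet r S
    · exact (ha s hs).2 h
    · simp [up_apply_not hr hb s h] at hs'
  rw [Finsupp.support_add_eq hd, Finset.card_union_of_disjoint hd, up_support hr,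
    Finset.card_image_of_injective _ (inj_mul hr)]

lemma main_nat {S : Set ℕ} (hS : ∀ s ∈ S, 0 < s) {n r j : ℕ} (hr : 2 ≤ r)
    (hsub : rSet r S ⊆ S) :
    ∑ p ∈ pr n r (PF S r) (fun b => PB S b ∧ b.support.card = j) n, (p.1 + r • p.2).support.card
      + TT S n r j (fun m => m = 1) =
    ∑ p ∈ pr n r (PG S r) (fun b => PB S b ∧ b.support.card = j) n, (p.1 + up r p.2).support.card
      + TT S n r (j + 1) (fun m => m = 1) := by
  classical
  have h1 : ∑ p ∈ pr n r (PF S r) (fun b => PB S b ∧ b.support.card = j) n,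
      (p.1 + r • p.2).support.card
      + TT S n r j (fun m => m = 1) + TT S n r j (fun m => 2 ≤ m) =
      ∑ p ∈ pr n r (PF S r) (fun b => PB S b ∧ b.support.card = j) n,
        (p.1.support.card + p.2.support.card) := by
    unfold TT
    rw [← Finset.sum_add_distrib, ← Finset.sum_add_distrib]
    apply Finset.sum_congr rfl
    intro p hp
    rw [mem_pr hS hr (fun f hf => hf.pb) le_rfl] at hp
    convert pair_card hr hp.1 hp.2.1 hp.2.2.2
  have h2 : ∑ p ∈ pr n r (PG S r) (fun b => PB S b ∧ b.support.card = j) n,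
      (p.1 + up r p.2).support.card =
      ∑ p ∈ pr n r (PG S r) (fun b => PB S b ∧ b.support.card = j) n,
        (p.1.support.card + p.2.support.card) := by
    apply Finset.sum_congr rfl
    intro p hp
    rw [mem_pr hS hr (fun f hf => hf.pb) le_rfl] at hp
    exact up_card hr hp.1 hp.2.1
  have h3 : ∑ p ∈ pr n r (PF S r) (fun b => PB S b ∧ b.support.card = j) n,
        (p.1.support.card + p.2.support.card) =
      ∑ p ∈ pr n r (PG S r) (fun b => PB S b ∧ b.support.card = j) n,
        (p.1.support.card + p.2.support.card) +
      ∑ b ∈ (U n).filter (fun b => PB S b ∧ b.support.card = j),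
        ∑ s ∈ R S n, C n (fun a => PF S r a ∧ a s ≠ 0) (r * s + r * wt b) n := by
    rw [sum_pr, sum_pr]
    have e : ∀ b : ℕ →₀ ℕ,
        ∑ a ∈ (U n).filter (fun a => PF S r a ∧ wt a + r * wt b = n),
          (a.support.card + b.support.card) =
        ∑ a ∈ (U n).filter (fun a => PG S r a ∧ wt a + r * wt b = n),
          (a.support.card + b.support.card) +
        ∑ s ∈ R S n, C n (fun a => PF S r a ∧ a s ≠ 0) (r * s + r * wt b) n := by
      intro b
      have g := glaisher hS hr hsub (r * wt b) n (le_refl n)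
      have g2 := base_beck hS hr hsub (le_refl n) (k := r * wt b)
      unfold C at g
      rw [Finset.sum_add_distrib, Finset.sum_add_distrib, Finset.sum_const, Finset.sum_const,
        g, g2]
      ring
    rw [Finset.sum_congr rfl (fun b _ => e b), Finset.sum_add_distrib]
    congr 1
    apply Finset.sum_congr _ (fun _ _ => rfl)
    ext b; simp
  have h4 := key hS (n := n) (j := j) hr
  have h5 : ∀ x y z : ℕ, x = y + z → z = x - y := by omega
  rw [h3] at h1
  have h6 : ∑ b ∈ (U n).filter (fun b => PB S b ∧ b.support.card = j),
        ∑ s ∈ R S n, C n (fun a => PF S r a ∧ a s ≠ 0) (r * s + r * wt b) n =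
    TT S n r (j + 1) (fun m => m = 1) + TT S n r j (fun m => 2 ≤ m) := by
    rw [← h4]
  rw [h6] at h1
  rw [h2]
  omega

lemma transfer (S : Set ℕ) (n : ℕ) (Q : (ℕ →₀ ℕ) → Prop) (φ : (ℕ →₀ ℕ) → ℕ)
    (A : Finset (Nat.Partition n))
    (hA : ∀ p, p ∈ A ↔ PB S (Multiset.toFinsupp p.parts) ∧ Q (Multiset.toFinsupp p.parts))
    (B : Finset (ℕ →₀ ℕ)) (hB : ∀ f, f ∈ B ↔ f ∈ U n ∧ PB S f ∧ Q f ∧ wt f = n) :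
    ∑ p ∈ A, φ (Multiset.toFinsupp p.parts) = ∑ f ∈ B, φ f := by
  refine Finset.sum_bij (fun p _ => Multiset.toFinsupp p.parts) ?_ ?_ ?_ ?_
  · intro p hp
    rw [hA] at hp
    rw [hB]
    refine ⟨?_, hp.1, hp.2, by rw [wt_toFinsupp, p.parts_sum]⟩
    rw [mem_U]
    refine ⟨?_, by rw [wt_toFinsupp, p.parts_sum]⟩
    simp only [Multiset.toFinsupp_apply, Multiset.count_eq_zero]
    intro h
    exact absurd (p.parts_pos h) (lt_irrefl _)
  · intro p _ q _ h
    exact Nat.Partition.ext (Multiset.toFinsupp.injective h)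
  · intro f hf
    rw [hB, mem_U] at hf
    obtain ⟨⟨h0, _⟩, h1, h2, h3⟩ := hf
    refine ⟨⟨Finsupp.toMultiset f, ?_, h3⟩, ?_, by simp⟩
    · intro i hi
      rcases Nat.eq_zero_or_pos i with rfl | h
      · exfalso
        simp at hi
        exact hi h0
      · exact h
    · rw [hA]; simpa using ⟨h1, h2⟩
  · intros; rfl

lemma qt_card {r : ℕ} (hr : 2 ≤ r) (f : ℕ →₀ ℕ) :
    (f.support.filter (fun i => r ≤ f i)).card = (qt r f).support.card := by
  congr 1
  ext s
  simp only [Finset.mem_filter, Finsupp.mem_support_iff, qt_apply]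
  rw [Ne, Ne, Nat.div_eq_zero_iff]
  omega

open scoped Classical in
lemma dn_card {r : ℕ} (hr : 2 ≤ r) (S : Set ℕ) (f : ℕ →₀ ℕ) :
    (f.support.filter (fun i => i ∈ rSet r S)).card = (dn r hr S f).support.card := by
  rw [← Finset.card_image_of_injective (dn r hr S f).support (inj_mul hr)]
  congr 1
  ext s
  simp only [Finset.mem_filter, Finsupp.mem_support_iff, Finset.mem_image]
  constructor
  · rintro ⟨h1, t, ht, rfl⟩
    exact ⟨t, by rw [dn_apply hr S f t ht]; exact h1, rfl⟩
  · rintro ⟨t, ht, rfl⟩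
    have h : t ∈ S := dn_pb hr S f t (by simpa using ht)
    rw [dn_apply hr S f t h] at ht
    exact ⟨ht, (mem_rSet hr).2 h⟩

lemma mem_setDt (S : Set ℕ) (n r j : ℕ) (p : Nat.Partition n) :
    p ∈ setDt S j r n ↔ (∀ i ∈ p.parts, i ∈ S) ∧
      (p.parts.toFinset.filter fun i => r ≤ p.parts.count i).card = j := by
  unfold setDt
  simp only [Finset.mem_filter, Finset.mem_univ, true_and]
  congr!

lemma mem_setDtLe (S : Set ℕ) (n r j : ℕ) (p : Nat.Partition n) :
    p ∈ setDtLe S j r n ↔ (∀ i ∈ p.parts, i ∈ S) ∧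
      (p.parts.toFinset.filter fun i => r ≤ p.parts.count i).card ≤ j := by
  unfold setDtLe
  simp only [Finset.mem_filter, Finset.mem_univ, true_and]
  congr!

open scoped Classical in
lemma mem_setOt (S S2 : Set ℕ) (n r j : ℕ) (p : Nat.Partition n) :
    p ∈ setOt S S2 j r n ↔ (∀ i ∈ p.parts, i ∉ rSet r S → i ∈ S2) ∧
      (p.parts.toFinset.filter fun i => i ∈ rSet r S).card = j := by
  unfold setOt
  simp only [Finset.mem_filter, Finset.mem_univ, true_and, Multiset.mem_toFinset]
  rw [and_comm]
  congr!

open scoped Classical in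
lemma mem_setOtLe (S S2 : Set ℕ) (n r j : ℕ) (p : Nat.Partition n) :
    p ∈ setOtLe S S2 j r n ↔ (∀ i ∈ p.parts, i ∉ rSet r S → i ∈ S2) ∧
      (p.parts.toFinset.filter fun i => i ∈ rSet r S).card ≤ j := by
  unfold setOtLe
  simp only [Finset.mem_filter, Finset.mem_univ, true_and, Multiset.mem_toFinset]
  rw [and_comm]
  congr!

lemma mem_Dt {S : Set ℕ} {n r j : ℕ} (hr : 2 ≤ r) (p : Nat.Partition n) :
    p ∈ setDt S j r n ↔ PB S (Multiset.toFinsupp p.parts) ∧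
      (qt r (Multiset.toFinsupp p.parts)).support.card = j := by
  rw [mem_setDt, ← qt_card hr]
  simp only [PB, Multiset.toFinsupp_support, Multiset.mem_toFinset, Multiset.toFinsupp_apply]
  congr!

lemma mem_Ot {S S2 : Set ℕ} {n r j : ℕ} (hr : 2 ≤ r) (h : IsEulerPair r S S2)
    (p : Nat.Partition n) :
    p ∈ setOt S S2 j r n ↔ PB S (Multiset.toFinsupp p.parts) ∧
      (dn r hr S (Multiset.toFinsupp p.parts)).support.card = j := by
  obtain ⟨h1, rfl⟩ := h
  rw [mem_setOt, ← dn_card hr]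
  simp only [PB, Multiset.toFinsupp_support, Multiset.mem_toFinset]
  refine and_congr ?_ (by congr!)
  refine forall₂_congr fun i _ => ?_
  constructor
  · intro h
    by_cases hi : i ∈ rSet r S
    · exact h1 hi
    · exact (h hi).1
  · intro h hi
    exact ⟨h, hi⟩

lemma D_sum {S : Set ℕ} (hS : ∀ s ∈ S, 0 < s) {n r j : ℕ} (hr : 2 ≤ r) (φ : (ℕ →₀ ℕ) → ℕ) :
    ∑ p ∈ setDt S j r n, φ (Multiset.toFinsupp p.parts) =
    ∑ p ∈ pr n r (PF S r) (fun b => PB S b ∧ b.support.card = j) n, φ (p.1 + r • p.2) := by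
  classical
  rw [← Dbij hS hr (Q := fun b => b.support.card = j) le_rfl φ]
  apply transfer S n (fun f => (qt r f).support.card = j) φ
  · exact mem_Dt hr
  · intro f; simp

lemma O_sum {S S2 : Set ℕ} (hS : ∀ s ∈ S, 0 < s) {n r j : ℕ} (hr : 2 ≤ r)
    (h : IsEulerPair r S S2) (φ : (ℕ →₀ ℕ) → ℕ) :
    ∑ p ∈ setOt S S2 j r n, φ (Multiset.toFinsupp p.parts) =
    ∑ p ∈ pr n r (PG S r) (fun b => PB S b ∧ b.support.card = j) n, φ (p.1 + up r p.2) := by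
  classical
  rw [← Obij hS hr h.1 (Q := fun b => b.support.card = j) le_rfl φ]
  apply transfer S n (fun f => (dn r hr S f).support.card = j) φ
  · exact mem_Ot hr h
  · intro f; simp

lemma T_eq {S : Set ℕ} (hS : ∀ s ∈ S, 0 < s) {n r j : ℕ} (hr : 2 ≤ r) :
    Tcountt S j r n = TT S n r j (fun m => m = 1) := by
  classical
  have h := D_sum hS (n := n) (j := j) hr
    (fun f => (f.support.filter (fun i => r + 1 ≤ f i ∧ f i ≤ 2 * r - 1)).card)
  unfold Tcountt TT
  simp only [Multiset.toFinsupp_support, Multiset.toFinsupp_apply] at h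
  refine Eq.trans ?_ (h.trans ?_)
  · apply Finset.sum_congr rfl
    intro p _
    congr!
  apply Finset.sum_congr rfl
  intro p hp
  rw [mem_pr hS hr (fun f hf => hf.pb) le_rfl] at hp
  obtain ⟨h1, h2, h3, h4⟩ := hp
  trans ((R S n).filter (fun s => p.1 s ≠ 0 ∧ p.2 s = 1)).card
  swap
  · rw [Finset.card_filter]
    congr!
  congr 1
  ext s
  simp only [Finset.mem_filter, Finsupp.mem_support_iff, mem_R]
  simp only [Finsupp.add_apply, Finsupp.smul_apply, smul_eq_mul]
  have hlt := h1.lt hr s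
  constructor
  · rintro ⟨g1, g2, g3⟩
    have hb1 : p.2 s = 1 := by
      have hb0 : p.2 s ≠ 0 := by
        intro h0; rw [h0] at g2; omega
      by_contra hb1
      have : r * 2 ≤ r * p.2 s := Nat.mul_le_mul_left _ (by omega)
      omega
    rw [hb1] at g2
    have ha : p.1 s ≠ 0 := by omega
    have hs : s ∈ p.1.support := by simpa using ha
    have := le_wt _ _ hs
    exact ⟨⟨by omega, h1.pb s hs⟩, ha, hb1⟩
  · rintro ⟨_, g2, g3⟩
    rw [g3]
    omega

lemma exact_nat {S S2 : Set ℕ} (hS : ∀ s ∈ S, 0 < s) {n r : ℕ} (j : ℕ) (hr : 2 ≤ r)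
    (h : IsEulerPair r S S2) :
    ∑ p ∈ setDt S j r n, numDistinctParts p + Tcountt S j r n =
    ∑ p ∈ setOt S S2 j r n, numDistinctParts p + Tcountt S (j + 1) r n := by
  have h1 := D_sum hS (n := n) (j := j) hr (fun f => f.support.card)
  have h2 := O_sum hS (n := n) (j := j) hr h (fun f => f.support.card)
  have h3 := main_nat hS (n := n) (j := j) hr h.1
  simp only [Multiset.toFinsupp_support] at h1 h2
  unfold numDistinctParts
  rw [T_eq hS hr, T_eq hS hr, h1, h2]
  exact h3

lemma T_zero (S : Set ℕ) (r n : ℕ) : Tcountt S 0 r n = 0 := by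
  unfold Tcountt
  apply Finset.sum_eq_zero
  intro p hp
  rw [mem_setDt, Finset.card_eq_zero, Finset.filter_eq_empty_iff] at hp
  rw [Finset.card_eq_zero, Finset.filter_eq_empty_iff]
  intro i hi hc
  exact hp.2 hi ((Nat.le_succ r).trans hc.1)

lemma sum_le {α : Type*} [DecidableEq α] (A Ale : ℕ → Finset α) (c : α → ℕ) (P : α → Prop) (f : α → ℤ)
    (hA : ∀ j p, p ∈ A j ↔ P p ∧ c p = j) (hle : ∀ j p, p ∈ Ale j ↔ P p ∧ c p ≤ j) (j : ℕ) :
    ∑ p ∈ Ale j, f p = ∑ i ∈ Finset.range (j + 1), ∑ p ∈ A i, f p := by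
  rw [← Finset.sum_biUnion]
  · apply Finset.sum_congr _ (fun _ _ => rfl)
    ext p
    simp only [Finset.mem_biUnion, Finset.mem_range, hA, hle]
    constructor
    · rintro ⟨h1, h2⟩
      exact ⟨c p, by omega, h1, rfl⟩
    · rintro ⟨i, hi, h1, h2⟩
      exact ⟨h1, by omega⟩
  · intro i _ k _ hik
    simp only [Function.onFun]
    rw [Finset.disjoint_left]
    intro p hp hp'
    rw [hA] at hp hp'
    exact hik (hp.2.symm.trans hp'.2)

lemma exact_int {S S2 : Set ℕ} (hS : ∀ s ∈ S, 0 < s) {n r : ℕ} (j : ℕ) (hr : 2 ≤ r)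
    (h : IsEulerPair r S S2) :
    bDifft' S S2 j r n = (Tcountt S (j + 1) r n : ℤ) - (Tcountt S j r n : ℤ) := by
  have := exact_nat hS (n := n) j hr h
  unfold bDifft'
  rw [← Nat.cast_sum, ← Nat.cast_sum]
  omega

lemma le_eq_sum (S S2 : Set ℕ) (n r j : ℕ) :
    bDifftLe' S S2 j r n = ∑ i ∈ Finset.range (j + 1), bDifft' S S2 i r n := by
  classical
  unfold bDifftLe' bDifft'
  rw [Finset.sum_sub_distrib]
  congr 1
  · refine sum_le (fun j => setDt S j r n) (fun j => setDtLe S j r n)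
      (fun p => (p.parts.toFinset.filter fun i => r ≤ p.parts.count i).card)
      (fun p => ∀ i ∈ p.parts, i ∈ S) _ ?_ ?_ j
    · exact mem_setDt S n r
    · exact mem_setDtLe S n r
  · refine sum_le (fun j => setOt S S2 j r n) (fun j => setOtLe S S2 j r n)
      (fun p => (p.parts.toFinset.filter fun i => i ∈ rSet r S).card)
      (fun p => ∀ i ∈ p.parts, i ∉ rSet r S → i ∈ S2) _ ?_ ?_ j
    · intro j p
      rw [mem_setOt]
    · intro j p
      rw [mem_setOtLe]

end EulerBeck

/-- For an Euler pair `(S₁, S₂)` of order `r`, `b̃'_{≤j,r}(n) = T̃_{j+1,r}(n)` and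
`b̃'_{j,r}(n) = T̃_{j+1,r}(n) - T̃_{j,r}(n)`. -/
theorem euler_pair_second_beck (r : ℕ) (hr : 2 ≤ r) (S1 S2 : Set ℕ)
    (hS1 : ∀ s ∈ S1, 0 < s) (hS2 : ∀ s ∈ S2, 0 < s)
    (hpair : IsEulerPair r S1 S2) (n j : ℕ) :
    bDifftLe' S1 S2 j r n = (Tcountt S1 (j + 1) r n : ℤ) ∧
      bDifft' S1 S2 j r n = (Tcountt S1 (j + 1) r n : ℤ) - (Tcountt S1 j r n : ℤ) := by
  refine ⟨?_, EulerBeck.exact_int hS1 j hr hpair⟩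
  rw [EulerBeck.le_eq_sum, Finset.sum_congr rfl (fun i _ => EulerBeck.exact_int hS1 i hr hpair),
    Finset.sum_range_sub (fun i => (Tcountt S1 i r n : ℤ)), EulerBeck.T_zero]
  simp
end
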